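/- arXiv:1310.4708 — 2 statements merged into one kernel-verified Lean document; each statement's English description precedes it below -/
import Mathlib

section
/- Let α be a nonzero real number, let U ⊆ ℝ × (0,∞) be open, and let u : ℝ × ℝ → ℝ be twice continuously differentiable on U and satisfy the equivariant Faddeev equation on U. Define Φ₂(t,r) = r⁻¹·∫_π^{u(t,r)} (1 + α²r⁻²sin²y)^{1/2} dy. Then on U, Φ₂ is twice continuously differentiable and satisfies ∂ₜₜΦ₂ − ∂ᵣᵣΦ₂ − 3r⁻¹∂ᵣΦ₂ = α⁻²·(Φ₂ − r⁻¹·∫_π^{u(t,r)} (1 + α²r⁻²sin²y)^{−3/2} dy). -/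
open MeasureTheory

/-- Partial derivative in the first (time) variable. -/
noncomputable def pdt (w : ℝ × ℝ → ℝ) : ℝ × ℝ → ℝ :=
  fun p => deriv (fun t => w (t, p.2)) p.1

/-- Partial derivative in the second (radial) variable. -/
noncomputable def pdr (w : ℝ × ℝ → ℝ) : ℝ × ℝ → ℝ :=
  fun p => deriv (fun r => w (p.1, r)) p.2

open ContinuousLinearMap (fst snd)
open Set Filter Topology

/-! ### Integrals with a parameter and a variable endpoint -/

section ParametricPrimitive

variable {V : Set ℝ} {f f' : ℝ → ℝ → ℝ} {a : ℝ}

lemma continuous_of_continuousOn_strip (hf : ContinuousOn f.uncurry (V ×ˢ univ)) {r : ℝ}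
    (hr : r ∈ V) : Continuous (f r) :=
  continuousOn_univ.1 <|
    hf.comp (f := fun y => (r, y)) (by fun_prop) fun y _ => ⟨hr, mem_univ y⟩

lemma continuousOn_parametric_primitive (hf : ContinuousOn f.uncurry (V ×ˢ univ)) :
    ContinuousOn (fun p : ℝ × ℝ => ∫ y in a..p.2, f p.1 y) (V ×ˢ univ) := by
  have hf' : Continuous (fun (r : V) (y : ℝ) => f r y).uncurry :=
    continuousOn_univ.1 <| hf.comp (f := fun q : V × ℝ => ((q.1 : ℝ), q.2)) (by fun_prop)
      fun q _ => ⟨q.1.2, mem_univ _⟩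
  have hF := intervalIntegral.continuous_parametric_primitive_of_continuous
    (μ := volume) (a₀ := a) hf'
  rw [continuousOn_iff_continuous_domRestrict]
  exact hF.comp (f := fun q : (V ×ˢ univ : Set (ℝ × ℝ)) => ((⟨q.1.1, q.2.1⟩ : V), q.1.2))
    (by fun_prop)

lemma hasDerivAt_parametric_integral (hV : IsOpen V) (hf : ContinuousOn f.uncurry (V ×ˢ univ))
    (hf' : ContinuousOn f'.uncurry (V ×ˢ univ))
    (hd : ∀ r ∈ V, ∀ y, HasDerivAt (fun r => f r y) (f' r y) r) {r : ℝ} (hr : r ∈ V) (z : ℝ) :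
    HasDerivAt (fun r => ∫ y in a..z, f r y) (∫ y in a..z, f' r y) r := by
  obtain ⟨ε, hε, hball⟩ := Metric.nhds_basis_closedBall.mem_iff.1 (hV.mem_nhds hr)
  obtain ⟨M, hM⟩ := ((isCompact_closedBall r ε).prod isCompact_uIcc).exists_bound_of_continuousOn
    (hf'.mono (prod_mono hball (subset_univ (uIcc a z))))
  refine (intervalIntegral.hasDerivAt_integral_of_dominated_loc_of_deriv_le
    (F' := f') (bound := fun _ => M) (Metric.closedBall_mem_nhds r hε) ?_ ?_ ?_ ?_ ?_ ?_).2
  · filter_upwards [hV.mem_nhds hr] with x hx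
    exact (continuous_of_continuousOn_strip hf hx).aestronglyMeasurable
  · exact (continuous_of_continuousOn_strip hf hr).intervalIntegrable _ _
  · exact (continuous_of_continuousOn_strip hf' hr).aestronglyMeasurable
  · exact .of_forall fun y hy x hx => hM (x, y) ⟨hx, uIoc_subset_uIcc hy⟩
  · exact intervalIntegrable_const
  · exact .of_forall fun y _ x hx => hd x (hball hx) y

lemma hasFDerivAt_parametric_primitive (hV : IsOpen V)
    (hf : ContinuousOn f.uncurry (V ×ˢ univ)) (hf' : ContinuousOn f'.uncurry (V ×ˢ univ))
    (hd : ∀ r ∈ V, ∀ y, HasDerivAt (fun r => f r y) (f' r y) r) {p : ℝ × ℝ}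
    (hp : p ∈ V ×ˢ (univ : Set ℝ)) :
    HasFDerivAt (fun q : ℝ × ℝ => ∫ y in a..q.2, f q.1 y)
      ((∫ y in a..p.2, f' p.1 y) • fst ℝ ℝ ℝ + f p.1 p.2 • snd ℝ ℝ ℝ) p := by
  have hnhds : ∀ᶠ q in 𝓝 p, q ∈ V ×ˢ (univ : Set ℝ) := (hV.prod isOpen_univ).mem_nhds hp
  have key := hasStrictFDerivAt_uncurry_coprod (𝕜 := ℝ) (u := p)
    (f := fun r z => ∫ y in a..z, f r y)
    (f₁ := fun r z => ContinuousLinearMap.toSpanSingleton ℝ (∫ y in a..z, f' r y))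
    (f₂ := fun r z => ContinuousLinearMap.toSpanSingleton ℝ (f r z)) ?_ ?_ ?_ ?_
  · refine key.hasFDerivAt.congr_fderiv ?_
    ext <;> simp [Function.HasUncurry.uncurry]
  · filter_upwards [hnhds] with q hq
    exact (hasDerivAt_parametric_integral hV hf hf' hd hq.1 q.2).hasFDerivAt
  · filter_upwards [hnhds] with q hq
    exact ((continuous_of_continuousOn_strip hf hq.1).integral_hasStrictDerivAt
      a q.2).hasDerivAt.hasFDerivAt
  · exact (ContinuousLinearMap.toSpanSingletonCLE (𝕜 := ℝ) (E := ℝ)).continuous.continuousAt.comp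
      ((continuousOn_parametric_primitive hf').continuousAt hnhds)
  · exact (ContinuousLinearMap.toSpanSingletonCLE (𝕜 := ℝ) (E := ℝ)).continuous.continuousAt.comp
      (hf.continuousAt hnhds)

lemma contDiffOn_succ_of_hasFDerivAt_prod {s : Set (ℝ × ℝ)} (hs : IsOpen s) {n : ℕ}
    {g A B : ℝ × ℝ → ℝ} (hA : ContDiffOn ℝ n A s) (hB : ContDiffOn ℝ n B s)
    (hg : ∀ p ∈ s, HasFDerivAt g (A p • fst ℝ ℝ ℝ + B p • snd ℝ ℝ ℝ) p) :
    ContDiffOn ℝ (n + 1) g s :=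
  (contDiffOn_succ_iff_hasFDerivWithinAt_of_uniqueDiffOn hs.uniqueDiffOn).2
    ⟨by simp, _, (hA.smul contDiffOn_const).add (hB.smul contDiffOn_const),
      fun p hp => (hg p hp).hasFDerivWithinAt⟩

lemma contDiffOn_two_parametric_primitive (hV : IsOpen V) {f'' : ℝ → ℝ → ℝ}
    (hf : ContDiffOn ℝ 1 f.uncurry (V ×ˢ univ)) (hf' : ContinuousOn f'.uncurry (V ×ˢ univ))
    (hf'' : ContinuousOn f''.uncurry (V ×ˢ univ))
    (hd : ∀ r ∈ V, ∀ y, HasDerivAt (fun r => f r y) (f' r y) r)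
    (hd' : ∀ r ∈ V, ∀ y, HasDerivAt (fun r => f' r y) (f'' r y) r) :
    ContDiffOn ℝ 2 (fun p : ℝ × ℝ => ∫ y in a..p.2, f p.1 y) (V ×ˢ univ) := by
  have hs : IsOpen (V ×ˢ (univ : Set ℝ)) := hV.prod isOpen_univ
  have hF' : ContDiffOn ℝ ((0 : ℕ) + 1) (fun p : ℝ × ℝ => ∫ y in a..p.2, f' p.1 y)
      (V ×ˢ univ) :=
    contDiffOn_succ_of_hasFDerivAt_prod hs
      (contDiffOn_zero.2 (continuousOn_parametric_primitive hf''))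
      (contDiffOn_zero.2 hf') fun p hp => hasFDerivAt_parametric_primitive hV hf' hf'' hd' hp
  have hF : ContDiffOn ℝ ((1 : ℕ) + 1) (fun p : ℝ × ℝ => ∫ y in a..p.2, f p.1 y) (V ×ˢ univ) :=
    contDiffOn_succ_of_hasFDerivAt_prod hs (hF'.of_le (by simp)) (by exact_mod_cast hf)
      fun p hp => hasFDerivAt_parametric_primitive hV hf.continuousOn hf' hd hp
  exact hF.of_le (by norm_num)

lemma hasDerivAt_parametric_primitive_comp (hV : IsOpen V)
    (hf : ContinuousOn f.uncurry (V ×ˢ univ)) (hf' : ContinuousOn f'.uncurry (V ×ˢ univ))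
    (hd : ∀ r ∈ V, ∀ y, HasDerivAt (fun r => f r y) (f' r y) r)
    {ρ ζ : ℝ → ℝ} {ρ' ζ' x : ℝ} (hρ : HasDerivAt ρ ρ' x) (hζ : HasDerivAt ζ ζ' x)
    (hx : ρ x ∈ V) :
    HasDerivAt (fun x => ∫ y in a..ζ x, f (ρ x) y)
      ((∫ y in a..ζ x, f' (ρ x) y) * ρ' + f (ρ x) (ζ x) * ζ') x := by
  have h := (hasFDerivAt_parametric_primitive (a := a) hV hf hf' hd
    (p := (ρ x, ζ x)) ⟨hx, mem_univ _⟩).comp_hasDerivAt x (hρ.prodMk hζ)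
  exact h.congr_deriv (by simp)

end ParametricPrimitive

/-! ### Slice derivatives -/

section Slices

variable {U : Set (ℝ × ℝ)} {w v : ℝ × ℝ → ℝ} {p : ℝ × ℝ}

lemma DifferentiableAt.hasDerivAt_pdt (h : DifferentiableAt ℝ w p) :
    HasDerivAt (fun t => w (t, p.2)) (pdt w p) p.1 :=
  (DifferentiableAt.comp (g := w) (f := fun t : ℝ => (t, p.2)) p.1 h
    (by fun_prop)).hasDerivAt

lemma DifferentiableAt.hasDerivAt_pdr (h : DifferentiableAt ℝ w p) :
    HasDerivAt (fun r => w (p.1, r)) (pdr w p) p.2 :=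
  (DifferentiableAt.comp (g := w) (f := fun r : ℝ => (p.1, r)) p.2 h
    (by fun_prop)).hasDerivAt

lemma DifferentiableAt.pdt_eq_fderiv (h : DifferentiableAt ℝ w p) :
    pdt w p = fderiv ℝ w p (1, 0) :=
  (HasFDerivAt.comp_hasDerivAt (f := fun t : ℝ => (t, p.2)) p.1 h.hasFDerivAt
    ((hasDerivAt_id p.1).prodMk (hasDerivAt_const p.1 p.2))).deriv

lemma DifferentiableAt.pdr_eq_fderiv (h : DifferentiableAt ℝ w p) :
    pdr w p = fderiv ℝ w p (0, 1) :=
  (HasFDerivAt.comp_hasDerivAt (f := fun r : ℝ => (p.1, r)) p.2 h.hasFDerivAt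
    ((hasDerivAt_const p.2 p.1).prodMk (hasDerivAt_id p.2))).deriv

lemma ContDiffOn.differentiableAt_pdt (hU : IsOpen U) (hw : ContDiffOn ℝ 2 w U) (hp : p ∈ U) :
    DifferentiableAt ℝ (pdt w) p := by
  have h1 : DifferentiableAt ℝ (fun q => fderiv ℝ w q (1, 0)) p :=
    (((hw.fderiv_of_isOpen hU (m := 1) (by norm_num)).differentiableOn one_ne_zero).differentiableAt
      (hU.mem_nhds hp)).clm_apply (differentiableAt_const _)
  refine h1.congr_of_eventuallyEq ?_
  filter_upwards [hU.mem_nhds hp] with q hq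
  exact ((hw.differentiableOn two_ne_zero).differentiableAt (hU.mem_nhds hq)).pdt_eq_fderiv

lemma ContDiffOn.differentiableAt_pdr (hU : IsOpen U) (hw : ContDiffOn ℝ 2 w U) (hp : p ∈ U) :
    DifferentiableAt ℝ (pdr w) p := by
  have h1 : DifferentiableAt ℝ (fun q => fderiv ℝ w q (0, 1)) p :=
    (((hw.fderiv_of_isOpen hU (m := 1) (by norm_num)).differentiableOn one_ne_zero).differentiableAt
      (hU.mem_nhds hp)).clm_apply (differentiableAt_const _)
  refine h1.congr_of_eventuallyEq ?_
  filter_upwards [hU.mem_nhds hp] with q hq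
  exact ((hw.differentiableOn two_ne_zero).differentiableAt (hU.mem_nhds hq)).pdr_eq_fderiv

lemma Set.EqOn.pdt_eq (hU : IsOpen U) (h : EqOn w v U) (hp : p ∈ U) : pdt w p = pdt v p := by
  refine EventuallyEq.deriv_eq ?_
  have hc : ContinuousAt (fun t : ℝ => (t, p.2)) p.1 := by fun_prop
  filter_upwards [hc.preimage_mem_nhds (hU.mem_nhds hp)] with t ht
  exact h ht

lemma Set.EqOn.pdr_eq (hU : IsOpen U) (h : EqOn w v U) (hp : p ∈ U) : pdr w p = pdr v p := by
  refine EventuallyEq.deriv_eq ?_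
  have hc : ContinuousAt (fun r : ℝ => (p.1, r)) p.2 := by fun_prop
  filter_upwards [hc.preimage_mem_nhds (hU.mem_nhds hp)] with r hr
  exact h hr

end Slices

/-! ### The integrand -/

section Integrand

/-- The square root of `1 + α² r⁻² sin² y`. -/
noncomputable def faddeevRoot (α r y : ℝ) : ℝ :=
  Real.sqrt (1 + α ^ 2 * Real.sin y ^ 2 / r ^ 2)

variable {α r y : ℝ}

lemma faddeevRoot_arg_pos (α r y : ℝ) : 0 < 1 + α ^ 2 * Real.sin y ^ 2 / r ^ 2 := by positivity

lemma faddeevRoot_pos (α r y : ℝ) : 0 < faddeevRoot α r y :=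
  Real.sqrt_pos.2 (faddeevRoot_arg_pos α r y)

lemma faddeevRoot_sq (α r y : ℝ) :
    faddeevRoot α r y ^ 2 = 1 + α ^ 2 * Real.sin y ^ 2 / r ^ 2 :=
  Real.sq_sqrt (faddeevRoot_arg_pos α r y).le

lemma rpow_neg_three_halves_eq_faddeevRoot (α r y : ℝ) :
    (1 + α ^ 2 * Real.sin y ^ 2 / r ^ 2) ^ (-(3 : ℝ) / 2) = (faddeevRoot α r y ^ 3)⁻¹ := by
  have h := faddeevRoot_pos α r y
  rw [← faddeevRoot_sq, ← Real.rpow_natCast_mul h.le, ← Real.rpow_natCast, ← Real.rpow_neg h.le]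
  norm_num

lemma contDiffOn_faddeevRoot (α : ℝ) :
    ContDiffOn ℝ 1 (fun p : ℝ × ℝ => faddeevRoot α p.1 p.2) (Ioi 0 ×ˢ univ) := by
  unfold faddeevRoot
  refine ContDiffOn.sqrt (contDiffOn_const.add (ContDiffOn.div (by fun_prop) (by fun_prop) ?_))
    fun p _ => (faddeevRoot_arg_pos α p.1 p.2).ne'
  exact fun p hp => pow_ne_zero 2 (ne_of_gt hp.1)

lemma hasDerivAt_faddeevRoot_comp (α : ℝ) {ρ ζ : ℝ → ℝ} {ρ' ζ' x : ℝ} (hρ : HasDerivAt ρ ρ' x)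
    (hζ : HasDerivAt ζ ζ' x) (hx : 0 < ρ x) :
    HasDerivAt (fun x => faddeevRoot α (ρ x) (ζ x))
      (-(faddeevRoot α (ρ x) (ζ x) ^ 2 - 1) / (ρ x * faddeevRoot α (ρ x) (ζ x)) * ρ'
        + α ^ 2 * Real.sin (ζ x) * Real.cos (ζ x)
          / (ρ x ^ 2 * faddeevRoot α (ρ x) (ζ x)) * ζ') x := by
  have h := ((((hζ.sin.pow 2).const_mul (α ^ 2)).div (hρ.pow 2)
    (pow_ne_zero 2 hx.ne')).const_add 1).sqrt (faddeevRoot_arg_pos α (ρ x) (ζ x)).ne'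
  refine h.congr_deriv ?_
  have hS := faddeevRoot_pos α (ρ x) (ζ x)
  simp only [Pi.pow_apply]
  rw [faddeevRoot_sq]
  change _ / (2 * faddeevRoot α (ρ x) (ζ x)) = _
  field_simp
  ring

/-- The integrand `r⁻¹ (1 + α² r⁻² sin² y)^{1/2}`. -/
noncomputable def faddeevDensity (α r y : ℝ) : ℝ := r⁻¹ * faddeevRoot α r y

/-- The radial derivative of `faddeevDensity`. -/
noncomputable def faddeevDensityDeriv (α r y : ℝ) : ℝ :=
  -(r ^ 2)⁻¹ * (2 * faddeevRoot α r y - (faddeevRoot α r y)⁻¹)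

/-- The second radial derivative of `faddeevDensity`. -/
noncomputable def faddeevDensityDeriv₂ (α r y : ℝ) : ℝ :=
  (r ^ 3)⁻¹ * (6 * faddeevRoot α r y - 3 * (faddeevRoot α r y)⁻¹ - (faddeevRoot α r y ^ 3)⁻¹)

lemma hasDerivAt_faddeevDensity_comp (α : ℝ) {ρ ζ : ℝ → ℝ} {ρ' ζ' x : ℝ} (hρ : HasDerivAt ρ ρ' x)
    (hζ : HasDerivAt ζ ζ' x) (hx : 0 < ρ x) :
    HasDerivAt (fun x => faddeevDensity α (ρ x) (ζ x))
      (faddeevDensityDeriv α (ρ x) (ζ x) * ρ'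
        + α ^ 2 * Real.sin (ζ x) * Real.cos (ζ x)
          / (ρ x ^ 3 * faddeevRoot α (ρ x) (ζ x)) * ζ') x := by
  refine ((hρ.inv hx.ne').mul (hasDerivAt_faddeevRoot_comp α hρ hζ hx)).congr_deriv ?_
  have hS := faddeevRoot_pos α (ρ x) (ζ x)
  unfold faddeevDensityDeriv
  simp only [Pi.inv_apply]
  field_simp
  ring

lemma hasDerivAt_faddeevDensity (α : ℝ) (hr : 0 < r) (y : ℝ) :
    HasDerivAt (fun r => faddeevDensity α r y) (faddeevDensityDeriv α r y) r := by
  simpa using hasDerivAt_faddeevDensity_comp α (hasDerivAt_id' r) (hasDerivAt_const r y) hr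

lemma hasDerivAt_faddeevDensityDeriv (α : ℝ) (hr : 0 < r) (y : ℝ) :
    HasDerivAt (fun r => faddeevDensityDeriv α r y) (faddeevDensityDeriv₂ α r y) r := by
  have hS := faddeevRoot_pos α r y
  have h := hasDerivAt_faddeevRoot_comp α (hasDerivAt_id' r) (hasDerivAt_const r y) hr
  refine ((((hasDerivAt_id' r).pow 2).inv (pow_ne_zero 2 hr.ne')).neg.mul
    ((h.const_mul 2).sub (h.inv hS.ne'))).congr_deriv ?_
  unfold faddeevDensityDeriv₂
  simp only [Pi.inv_apply, Pi.neg_apply, Pi.pow_apply, Pi.sub_apply]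
  field_simp
  ring

lemma contDiffOn_faddeevDensity (α : ℝ) :
    ContDiffOn ℝ 1 (faddeevDensity α).uncurry (Ioi 0 ×ˢ univ) :=
  (contDiffOn_fst.inv fun _ hp => ne_of_gt hp.1).mul (contDiffOn_faddeevRoot α)

lemma continuousOn_faddeevDensityDeriv (α : ℝ) :
    ContinuousOn (faddeevDensityDeriv α).uncurry (Ioi 0 ×ˢ univ) := by
  have h := (contDiffOn_faddeevRoot α).continuousOn
  exact ((continuousOn_fst.pow 2).inv₀ fun p hp => pow_ne_zero 2 (ne_of_gt hp.1)).neg.mul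
    ((h.const_mul 2).sub (h.inv₀ fun p _ => (faddeevRoot_pos α p.1 p.2).ne'))

lemma continuousOn_faddeevDensityDeriv₂ (α : ℝ) :
    ContinuousOn (faddeevDensityDeriv₂ α).uncurry (Ioi 0 ×ˢ univ) := by
  have h := (contDiffOn_faddeevRoot α).continuousOn
  have h0 (p : ℝ × ℝ) := (faddeevRoot_pos α p.1 p.2).ne'
  exact ((continuousOn_fst.pow 3).inv₀ fun p hp => pow_ne_zero 3 (ne_of_gt hp.1)).mul
    (((h.const_mul 6).sub ((h.inv₀ fun p _ => h0 p).const_mul 3)).sub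
      ((h.pow 3).inv₀ fun p _ => pow_ne_zero 3 (h0 p)))

lemma continuous_faddeevRoot (α r : ℝ) : Continuous (faddeevRoot α r) := by
  unfold faddeevRoot
  fun_prop

lemma integral_faddeevDensityDeriv₂_add (α : ℝ) (hα : α ≠ 0) (hr : 0 < r) (z : ℝ) :
    (∫ y in Real.pi..z, faddeevDensityDeriv₂ α r y)
        + 3 * r⁻¹ * (∫ y in Real.pi..z, faddeevDensityDeriv α r y)
      = -((r ^ 3)⁻¹ * Real.sin z * Real.cos z / faddeevRoot α r z)
        - (α ^ 2)⁻¹ * ((∫ y in Real.pi..z, faddeevDensity α r y)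
          - r⁻¹ * ∫ y in Real.pi..z, (faddeevRoot α r y ^ 3)⁻¹) := by
  have hS := continuous_faddeevRoot α r
  have hS0 (y : ℝ) : faddeevRoot α r y ≠ 0 := (faddeevRoot_pos α r y).ne'
  have hc : Continuous fun y => (faddeevRoot α r y ^ 3)⁻¹ :=
    (hS.pow 3).inv₀ fun y => pow_ne_zero 3 (hS0 y)
  have hc0 : Continuous (faddeevDensity α r) :=
    continuous_of_continuousOn_strip (contDiffOn_faddeevDensity α).continuousOn hr
  have hc1 : Continuous (faddeevDensityDeriv α r) :=
    continuous_of_continuousOn_strip (continuousOn_faddeevDensityDeriv α) hr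
  have hc2 : Continuous (faddeevDensityDeriv₂ α r) :=
    continuous_of_continuousOn_strip (continuousOn_faddeevDensityDeriv₂ α) hr
  have hcI : Continuous fun y => faddeevDensityDeriv₂ α r y + 3 * r⁻¹ * faddeevDensityDeriv α r y
      + (α ^ 2)⁻¹ * (faddeevDensity α r y - r⁻¹ * (faddeevRoot α r y ^ 3)⁻¹) :=
    (hc2.add (hc1.const_mul _)).add ((hc0.sub (hc.const_mul _)).const_mul _)
  have hprim (y : ℝ) : HasDerivAt
      (fun y => -((r ^ 3)⁻¹ * Real.sin y * Real.cos y / faddeevRoot α r y))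
      (faddeevDensityDeriv₂ α r y + 3 * r⁻¹ * faddeevDensityDeriv α r y
        + (α ^ 2)⁻¹ * (faddeevDensity α r y - r⁻¹ * (faddeevRoot α r y ^ 3)⁻¹)) y := by
    have h := (((((Real.hasDerivAt_sin y).const_mul (r ^ 3)⁻¹).mul (Real.hasDerivAt_cos y)).div
      (hasDerivAt_faddeevRoot_comp α (hasDerivAt_const y r) (hasDerivAt_id' y) hr) (hS0 y))).neg
    refine h.congr_deriv ?_
    have hsin : Real.sin y ^ 2 = r ^ 2 * (faddeevRoot α r y ^ 2 - 1) / α ^ 2 := by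
      rw [faddeevRoot_sq]
      field_simp
      ring
    have hcos : Real.cos y ^ 2 = 1 - r ^ 2 * (faddeevRoot α r y ^ 2 - 1) / α ^ 2 := by
      rw [Real.cos_sq', hsin]
    have h0 := hS0 y
    simp only [Pi.mul_apply]
    unfold faddeevDensityDeriv₂ faddeevDensityDeriv faddeevDensity
    generalize faddeevRoot α r y = S at *
    trans -((r ^ 3)⁻¹ * ((Real.cos y ^ 2 - Real.sin y ^ 2) / S
      - α ^ 2 * Real.sin y ^ 2 * Real.cos y ^ 2 / (r ^ 2 * S ^ 3)))
    · field_simp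
      ring
    · rw [hcos, hsin]
      field_simp
      ring
  have hint := intervalIntegral.integral_eq_sub_of_hasDerivAt (a := Real.pi) (b := z)
    (fun y _ => hprim y) (hcI.intervalIntegrable _ _)
  have i0 := hc0.intervalIntegrable (μ := volume) Real.pi z
  have i1 := hc1.intervalIntegrable (μ := volume) Real.pi z
  have i2 := hc2.intervalIntegrable (μ := volume) Real.pi z
  have i3 := hc.intervalIntegrable (μ := volume) Real.pi z
  rw [intervalIntegral.integral_add (i2.add (i1.const_mul _))
      ((i0.sub (i3.const_mul _)).const_mul _),
    intervalIntegral.integral_add i2 (i1.const_mul _), intervalIntegral.integral_const_mul,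
    intervalIntegral.integral_const_mul, intervalIntegral.integral_sub i0 (i3.const_mul _),
    intervalIntegral.integral_const_mul, Real.sin_pi] at hint
  linear_combination hint

end Integrand

/-- If `u` is `C²` on an open `U ⊆ ℝ × (0,∞)` and solves the equivariant Faddeev
equation there, then `Φ₂(t,r) = r⁻¹∫_π^{u(t,r)} (1 + α²r⁻²sin²y)^{1/2} dy` is `C²` on `U`
and satisfies `∂ₜₜΦ₂ − ∂ᵣᵣΦ₂ − 3r⁻¹∂ᵣΦ₂ = α⁻²(Φ₂ − r⁻¹∫_π^u (1+α²r⁻²sin²y)^{−3/2} dy)`. -/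
theorem stmt2 (α : ℝ) (hα : α ≠ 0) (U : Set (ℝ × ℝ)) (hU : IsOpen U)
    (hUsub : ∀ p ∈ U, 0 < p.2) (u : ℝ × ℝ → ℝ) (hu : ContDiffOn ℝ 2 u U)
    (A₁ : ℝ × ℝ → ℝ) (hA₁ : ∀ p : ℝ × ℝ, A₁ p = 1 + α ^ 2 * Real.sin (u p) ^ 2 / p.2 ^ 2)
    (hFaddeev : ∀ p ∈ U,
      pdt (pdt u) p - pdr (pdr u) p - p.2⁻¹ * pdr u p
        = -2 * p.2⁻¹ * (1 - (A₁ p)⁻¹) * pdr u p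
          - (p.2 ^ 2)⁻¹ * (A₁ p)⁻¹ * (α ^ 2 * ((pdt u p) ^ 2 - (pdr u p) ^ 2) + 1)
            * Real.sin (u p) * Real.cos (u p))
    (Φ₂ : ℝ × ℝ → ℝ)
    (hΦ₂ : ∀ p : ℝ × ℝ,
      Φ₂ p = p.2⁻¹ * ∫ y in Real.pi..(u p), Real.sqrt (1 + α ^ 2 * Real.sin y ^ 2 / p.2 ^ 2)) :
    ContDiffOn ℝ 2 Φ₂ U ∧
    ∀ p ∈ U,
      pdt (pdt Φ₂) p - pdr (pdr Φ₂) p - 3 * p.2⁻¹ * pdr Φ₂ p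
        = (α ^ 2)⁻¹ * (Φ₂ p
            - p.2⁻¹ * ∫ y in Real.pi..(u p),
                (1 + α ^ 2 * Real.sin y ^ 2 / p.2 ^ 2) ^ (-(3 : ℝ) / 2)) := by
  have hV : IsOpen (Ioi (0 : ℝ)) := isOpen_Ioi
  have hf := contDiffOn_faddeevDensity α
  have hf' := continuousOn_faddeevDensityDeriv α
  have hf'' := continuousOn_faddeevDensityDeriv₂ α
  have hd : ∀ r ∈ Ioi (0 : ℝ), ∀ y,
      HasDerivAt (fun r => faddeevDensity α r y) (faddeevDensityDeriv α r y) r :=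
    fun r hr y => hasDerivAt_faddeevDensity α hr y
  have hd' : ∀ r ∈ Ioi (0 : ℝ), ∀ y,
      HasDerivAt (fun r => faddeevDensityDeriv α r y) (faddeevDensityDeriv₂ α r y) r :=
    fun r hr y => hasDerivAt_faddeevDensityDeriv α hr y
  have hΦ : Φ₂ = fun p => ∫ y in Real.pi..u p, faddeevDensity α p.2 y := by
    funext p
    rw [hΦ₂, ← intervalIntegral.integral_const_mul]
    rfl
  have hmaps : MapsTo (fun p => (p.2, u p)) U (Ioi (0 : ℝ) ×ˢ univ) :=
    fun p hp => ⟨hUsub p hp, mem_univ _⟩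
  have hsmooth : ContDiffOn ℝ 2 Φ₂ U := by
    rw [hΦ]
    exact (contDiffOn_two_parametric_primitive hV hf hf' hf'' hd hd').comp
      (contDiffOn_snd.prodMk hu) hmaps
  refine ⟨hsmooth, fun p hp => ?_⟩
  have hudiff (q : ℝ × ℝ) (hq : q ∈ U) : DifferentiableAt ℝ u q :=
    (hu.differentiableOn two_ne_zero).differentiableAt (hU.mem_nhds hq)
  have hΦt : EqOn (pdt Φ₂) (fun q => faddeevDensity α q.2 (u q) * pdt u q) U := by
    intro q hq
    rw [hΦ]
    exact (hasDerivAt_parametric_primitive_comp (a := Real.pi) hV hf.continuousOn hf' hd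
      (hasDerivAt_const q.1 q.2) (hudiff q hq).hasDerivAt_pdt (hUsub q hq)).deriv.trans (by simp)
  have hΦr : EqOn (pdr Φ₂) (fun q => (∫ y in Real.pi..u q, faddeevDensityDeriv α q.2 y)
      + faddeevDensity α q.2 (u q) * pdr u q) U := by
    intro q hq
    rw [hΦ]
    exact (hasDerivAt_parametric_primitive_comp (a := Real.pi) hV hf.continuousOn hf' hd
      (hasDerivAt_id' q.2) (hudiff q hq).hasDerivAt_pdr (hUsub q hq)).deriv.trans (by simp)
  have hr := hUsub p hp
  have hut := (hudiff p hp).hasDerivAt_pdt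
  have hur := (hudiff p hp).hasDerivAt_pdr
  have hΦtt := ((hasDerivAt_faddeevDensity_comp α (hasDerivAt_const p.1 p.2) hut hr).mul
    (hu.differentiableAt_pdt hU hp).hasDerivAt_pdt).deriv
  have hΦrr := ((hasDerivAt_parametric_primitive_comp (a := Real.pi) hV hf' hf'' hd'
    (hasDerivAt_id' p.2) hur hr).add
    ((hasDerivAt_faddeevDensity_comp α (hasDerivAt_id' p.2) hur hr).mul
      (hu.differentiableAt_pdr hU hp).hasDerivAt_pdr)).deriv
  have hPDE := hFaddeev p hp
  have hint := integral_faddeevDensityDeriv₂_add α hα hr (u p)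
  have hS0 := (faddeevRoot_pos α p.2 (u p)).ne'
  rw [hA₁, ← faddeevRoot_sq] at hPDE
  rw [(hΦt.pdt_eq hU hp).trans hΦtt, (hΦr.pdr_eq hU hp).trans hΦrr, hΦr hp]
  simp only [rpow_neg_three_halves_eq_faddeevRoot, hΦ]
  simp only [Prod.mk.eta]
  simp only [faddeevDensity, faddeevDensityDeriv] at hint ⊢
  generalize faddeevRoot α p.2 (u p) = S at *
  have hinv : S * (S ^ 2)⁻¹ = S⁻¹ := by
    field_simp
  linear_combination (p.2⁻¹ * S) * hPDE - hint
    + (2 * p.2⁻¹ ^ 2 * pdr u p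
      - p.2⁻¹ ^ 3 * Real.sin (u p) * Real.cos (u p)
        * (α ^ 2 * (pdt u p ^ 2 - pdr u p ^ 2) + 1)) * hinv
end

section
/- Let α be a real number and define F̃₂ : ℝ → ℝ by F̃₂(x) = α²·x⁻³·sin x·(cos x − x⁻¹·sin x) for x ≠ 0 and F̃₂(0) = −α²/3. Then: F̃₂ is real-analytic on all of ℝ; F̃₂ is even; for every k ∈ ℕ there is a constant C_k such that |F̃₂^{(k)}(x)| ≤ C_k for all x ∈ ℝ; and for every k ∈ ℕ, F̃₂^{(k)}(x) → 0 as |x| → ∞. -/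
/-- The algebra of functions on `ℝ` generated by `x⁻¹`, `sin x` and `cos x`. -/
def invTrigAlgebra : Subalgebra ℝ (ℝ → ℝ) :=
  Algebra.adjoin ℝ {fun x => x⁻¹, Real.sin, Real.cos}

lemma inv_mem_invTrigAlgebra : (fun x : ℝ => x⁻¹) ∈ invTrigAlgebra :=
  Algebra.subset_adjoin (by simp)

lemma sin_mem_invTrigAlgebra : Real.sin ∈ invTrigAlgebra :=
  Algebra.subset_adjoin (by simp)

lemma cos_mem_invTrigAlgebra : Real.cos ∈ invTrigAlgebra :=
  Algebra.subset_adjoin (by simp)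

lemma exists_abs_le_of_mem_invTrigAlgebra {g : ℝ → ℝ} (hg : g ∈ invTrigAlgebra) :
    ∃ C, ∀ x, 1 ≤ |x| → |g x| ≤ C := by
  induction hg using Algebra.adjoin_induction with
  | mem g hg =>
    refine ⟨1, fun x hx => ?_⟩
    rcases hg with rfl | rfl | rfl
    · simpa only [abs_inv] using inv_le_one_of_one_le₀ hx
    · exact Real.abs_sin_le_one x
    · exact Real.abs_cos_le_one x
  | algebraMap r => exact ⟨|r|, fun x _ => le_rfl⟩
  | add f g _ _ hf hg =>
    obtain ⟨C, hC⟩ := hf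
    obtain ⟨D, hD⟩ := hg
    exact ⟨C + D, fun x hx => (abs_add_le _ _).trans (add_le_add (hC x hx) (hD x hx))⟩
  | mul f g _ _ hf hg =>
    obtain ⟨C, hC⟩ := hf
    obtain ⟨D, hD⟩ := hg
    refine ⟨C * D, fun x hx => ?_⟩
    rw [Pi.mul_apply, abs_mul]
    exact mul_le_mul (hC x hx) (hD x hx) (abs_nonneg _) ((abs_nonneg _).trans (hC x hx))

lemma exists_hasDerivAt_of_mem_invTrigAlgebra {g : ℝ → ℝ} (hg : g ∈ invTrigAlgebra) :
    ∃ g' ∈ invTrigAlgebra, ∀ x, x ≠ 0 → HasDerivAt g (g' x) x := by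
  induction hg using Algebra.adjoin_induction with
  | mem g hg =>
    rcases hg with rfl | rfl | rfl
    · refine ⟨_, neg_mem (pow_mem inv_mem_invTrigAlgebra 2), fun x hx => ?_⟩
      simpa using hasDerivAt_inv hx
    · exact ⟨_, cos_mem_invTrigAlgebra, fun x _ => Real.hasDerivAt_sin x⟩
    · exact ⟨_, neg_mem sin_mem_invTrigAlgebra, fun x _ => Real.hasDerivAt_cos x⟩
  | algebraMap r => exact ⟨0, zero_mem _, fun x _ => hasDerivAt_const x r⟩
  | add f g _ _ hf hg =>
    obtain ⟨f', hf', hf⟩ := hf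
    obtain ⟨g', hg', hg⟩ := hg
    exact ⟨f' + g', add_mem hf' hg', fun x hx => (hf x hx).add (hg x hx)⟩
  | mul f g hfm hgm hf hg =>
    obtain ⟨f', hf', hf⟩ := hf
    obtain ⟨g', hg', hg⟩ := hg
    exact ⟨f' * g + f * g', add_mem (mul_mem hf' hgm) (mul_mem hfm hg'),
      fun x hx => (hf x hx).mul (hg x hx)⟩

lemma exists_iteratedDeriv_eq_inv_mul {f g : ℝ → ℝ} (hg : g ∈ invTrigAlgebra)
    (hf : ∀ x, x ≠ 0 → f x = x⁻¹ * g x) (k : ℕ) :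
    ∃ h ∈ invTrigAlgebra, ∀ x, x ≠ 0 → iteratedDeriv k f x = x⁻¹ * h x := by
  induction k with
  | zero => exact ⟨g, hg, by simpa using hf⟩
  | succ k ih =>
    obtain ⟨h, hh, hk⟩ := ih
    obtain ⟨h', hh', hd⟩ := exists_hasDerivAt_of_mem_invTrigAlgebra hh
    refine ⟨_, sub_mem hh' (mul_mem inv_mem_invTrigAlgebra hh), fun x hx => ?_⟩
    have heq : iteratedDeriv k f =ᶠ[nhds x] fun y => y⁻¹ * h y := by
      filter_upwards [isOpen_ne.mem_nhds hx] with y hy using hk y hy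
    rw [iteratedDeriv_succ, heq.deriv_eq, ((hasDerivAt_inv hx).fun_mul (hd x hx)).deriv]
    simp only [Pi.sub_apply, Pi.mul_apply]
    field_simp
    ring

lemma tendsto_inv_mul_cocompact {f g : ℝ → ℝ} (hg : g ∈ invTrigAlgebra)
    (hf : ∀ x, x ≠ 0 → f x = x⁻¹ * g x) :
    Filter.Tendsto f (Filter.cocompact ℝ) (nhds 0) := by
  obtain ⟨C, hC⟩ := exists_abs_le_of_mem_invTrigAlgebra hg
  have hlarge : ∀ᶠ x : ℝ in Filter.cocompact ℝ, 1 ≤ |x| := by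
    simpa using (tendsto_norm_cocompact_atTop (E := ℝ)).eventually_ge_atTop 1
  have hinv : Filter.Tendsto (fun x : ℝ => |x|⁻¹ * C) (Filter.cocompact ℝ) (nhds 0) := by
    simpa using (tendsto_norm_cocompact_atTop (E := ℝ)).inv_tendsto_atTop.mul_const C
  refine squeeze_zero_norm' ?_ hinv
  filter_upwards [hlarge] with x hx
  have hx0 : x ≠ 0 := abs_pos.mp (one_pos.trans_le hx)
  rw [hf x hx0, Real.norm_eq_abs, abs_mul, abs_inv]
  exact mul_le_mul_of_nonneg_left (hC x hx) (by positivity)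

lemma exists_abs_le_of_tendsto_cocompact {f : ℝ → ℝ} (hf : Continuous f)
    (h : Filter.Tendsto f (Filter.cocompact ℝ) (nhds 0)) : ∃ C, ∀ x, |f x| ≤ C := by
  let b := (ZeroAtInftyContinuousMap.mk ⟨f, hf⟩ h).toBCF
  exact ⟨‖b‖, b.norm_coe_le_norm⟩

lemma tendsto_mul_cos_sub_sin_div_cube :
    Filter.Tendsto (fun x : ℝ => (x * Real.cos x - Real.sin x) / x ^ 3)
      (nhdsWithin 0 {0}ᶜ) (nhds (-1 / 3)) := by
  have hsinc : Filter.Tendsto (fun x : ℝ => -Real.sinc x / 3) (nhdsWithin 0 {0}ᶜ)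
      (nhds (-1 / 3)) := by
    have : Continuous fun x : ℝ => -Real.sinc x / 3 := by fun_prop
    simpa using (this.tendsto 0).mono_left nhdsWithin_le_nhds
  refine HasDerivAt.lhopital_zero_nhdsNE (f' := fun x => -x * Real.sin x)
    (g' := fun x => 3 * x ^ 2) ?_ ?_ ?_ ?_ ?_ ?_
  · refine Filter.Eventually.of_forall fun x => ?_
    refine (((hasDerivAt_id' x).fun_mul (Real.hasDerivAt_cos x)).fun_sub
      (Real.hasDerivAt_sin x)).congr_deriv ?_
    ring
  · refine Filter.Eventually.of_forall fun x => ?_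
    simpa using hasDerivAt_pow 3 x
  · filter_upwards [self_mem_nhdsWithin] with x hx
    have : x ≠ 0 := hx
    positivity
  · have : Continuous fun x : ℝ => x * Real.cos x - Real.sin x := by fun_prop
    simpa using (this.tendsto 0).mono_left nhdsWithin_le_nhds
  · have : Continuous fun x : ℝ => x ^ 3 := by fun_prop
    simpa using (this.tendsto 0).mono_left nhdsWithin_le_nhds
  · refine hsinc.congr' ?_
    filter_upwards [self_mem_nhdsWithin] with x hx
    have : x ≠ 0 := hx
    rw [Real.sinc_of_ne_zero this]
    field_simp


/-- Properties of `F̃₂(x) = α²x⁻³ sin x (cos x − x⁻¹ sin x)` (with `F̃₂(0) = −α²/3`): it is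
real-analytic on `ℝ`, even, and all of its iterated derivatives are bounded and
tend to `0` at infinity. -/
theorem stmt11 (α : ℝ) (F : ℝ → ℝ)
    (hF : ∀ x : ℝ,
      F x = if x = 0 then -α ^ 2 / 3
        else α ^ 2 * (x ^ 3)⁻¹ * Real.sin x * (Real.cos x - x⁻¹ * Real.sin x)) :
    AnalyticOnNhd ℝ F Set.univ ∧
    (∀ x : ℝ, F (-x) = F x) ∧
    (∀ k : ℕ, ∃ C : ℝ, ∀ x : ℝ, |iteratedDeriv k F x| ≤ C) ∧
    (∀ k : ℕ, Filter.Tendsto (iteratedDeriv k F) (Filter.cocompact ℝ) (nhds 0)) := by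
  have hne : ∀ x, x ≠ 0 →
      F x = α ^ 2 * (x ^ 3)⁻¹ * Real.sin x * (Real.cos x - x⁻¹ * Real.sin x) :=
    fun x hx => by rw [hF, if_neg hx]
  have hcont : ContinuousAt F 0 := by
    rw [continuousAt_iff_punctured_nhds, hF 0, if_pos rfl]
    have hsinc : Filter.Tendsto Real.sinc (nhdsWithin 0 {0}ᶜ) (nhds 1) := by
      simpa using (Real.continuous_sinc.tendsto 0).mono_left nhdsWithin_le_nhds
    have := (hsinc.const_mul (α ^ 2)).mul tendsto_mul_cos_sub_sin_div_cube
    rw [show α ^ 2 * 1 * (-1 / 3) = -α ^ 2 / 3 by ring] at this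
    refine this.congr' ?_
    filter_upwards [self_mem_nhdsWithin] with x hx
    have hx : x ≠ 0 := hx
    rw [hne x hx, Real.sinc_of_ne_zero hx]
    field_simp
  have hana : AnalyticOnNhd ℝ F Set.univ := by
    have hmero : ∀ x, MeromorphicAt
        (fun x : ℝ => α ^ 2 * (x ^ 3)⁻¹ * Real.sin x * (Real.cos x - x⁻¹ * Real.sin x)) x := by
      intro x
      have hsin := (Real.analyticAt_sin (x := x)).meromorphicAt
      have hcos := (Real.analyticAt_cos (x := x)).meromorphicAt
      fun_prop
    intro x _
    rcases eq_or_ne x 0 with rfl | hx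
    · refine ((hmero 0).congr ?_).analyticAt hcont
      filter_upwards [self_mem_nhdsWithin] with x hx using (hne x hx).symm
    · have heq : (fun x : ℝ => α ^ 2 * (x ^ 3)⁻¹ * Real.sin x *
          (Real.cos x - x⁻¹ * Real.sin x)) =ᶠ[nhds x] F := by
        filter_upwards [isOpen_ne.mem_nhds hx] with y hy using (hne y hy).symm
      refine AnalyticAt.congr ?_ heq
      have hx3 : x ^ 3 ≠ 0 := pow_ne_zero 3 hx
      fun_prop (disch := assumption)
  have hlim : ∀ k, Filter.Tendsto (iteratedDeriv k F) (Filter.cocompact ℝ) (nhds 0) := by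
    intro k
    have hmem : (α ^ 2) • ((fun x : ℝ => x⁻¹) ^ 2 * Real.sin *
        (Real.cos - (fun x : ℝ => x⁻¹) * Real.sin)) ∈ invTrigAlgebra :=
      Subalgebra.smul_mem _ (mul_mem (mul_mem (pow_mem inv_mem_invTrigAlgebra 2)
        sin_mem_invTrigAlgebra) (sub_mem cos_mem_invTrigAlgebra
          (mul_mem inv_mem_invTrigAlgebra sin_mem_invTrigAlgebra))) _
    obtain ⟨h, hh, hk⟩ := exists_iteratedDeriv_eq_inv_mul (f := F) hmem (fun x hx => by
      rw [hne x hx]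
      simp only [Pi.smul_apply, Pi.mul_apply, Pi.sub_apply, Pi.pow_apply, smul_eq_mul]
      field_simp) k
    exact tendsto_inv_mul_cocompact hh hk
  refine ⟨hana, fun x => ?_, fun k => ?_, hlim⟩
  · rcases eq_or_ne x 0 with rfl | hx
    · simp
    · rw [hne x hx, hne (-x) (neg_ne_zero.mpr hx), Real.sin_neg, Real.cos_neg]
      field_simp
  · refine exists_abs_le_of_tendsto_cocompact ?_ (hlim k)
    have hsmooth : ContDiff ℝ k F := contDiff_iff_contDiffAt.mpr fun x =>
      (hana x (Set.mem_univ x)).contDiffAt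
    exact hsmooth.continuous_iteratedDeriv k le_rfl
end
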